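/- Let 𝒞 be a triangulated category with a proper class ξ of triangles and enough ξ-projectives, and let A be an object of 𝒞. Then A is ξ-Gorenstein projective if and only if there exists a Hom(−,𝒫(ξ))-exact triangle A → G → A → ΣA in ξ with G ∈ 𝒢𝒫(ξ). -/

import Mathlib

open CategoryTheory CategoryTheory.Limits CategoryTheory.Pretriangulated

namespace GorensteinTriangulated

variable {C : Type*} [Category C] [HasZeroObject C] [HasShift C ℤ] [Preadditive C]
  [∀ n : ℤ, (shiftFunctor C n).Additive] [Pretriangulated C]

/-- A triangle `A ⟶ B ⟶ C ⟶ ΣA` is split if it is isomorphic to the triangle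
`A ⟶ A ⊞ C ⟶ C ⟶ ΣA` with structure maps `(1 0)`, `(0 1)ᵀ` and `0`. -/
def IsSplitTriangle (T : Triangle C) : Prop :=
  Nonempty (T ≅ Triangle.mk (biprod.inl : T.obj₁ ⟶ T.obj₁ ⊞ T.obj₃) biprod.snd
    (0 : T.obj₃ ⟶ T.obj₁⟦(1 : ℤ)⟧))

/-- The triangle `T` becomes a short exact sequence after applying `Hom(Q, -)`. -/
def CoExact (T : Triangle C) (Q : C) : Prop :=
  Function.Injective (fun φ : Q ⟶ T.obj₁ => φ ≫ T.mor₁) ∧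
  (∀ φ : Q ⟶ T.obj₂, φ ≫ T.mor₂ = 0 → ∃ ψ : Q ⟶ T.obj₁, φ = ψ ≫ T.mor₁) ∧
  Function.Surjective (fun φ : Q ⟶ T.obj₂ => φ ≫ T.mor₂)

/-- The triangle `T` becomes a short exact sequence after applying `Hom(-, Q)`. -/
def ContraExact (T : Triangle C) (Q : C) : Prop :=
  Function.Injective (fun φ : T.obj₃ ⟶ Q => T.mor₂ ≫ φ) ∧
  (∀ φ : T.obj₂ ⟶ Q, T.mor₁ ≫ φ = 0 → ∃ ψ : T.obj₃ ⟶ Q, φ = T.mor₂ ≫ ψ) ∧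
  Function.Surjective (fun φ : T.obj₂ ⟶ Q => T.mor₁ ≫ φ)

/-- Saturation of a class of triangles with respect to base change: in a base change
diagram, if the third vertical triangle and the second horizontal triangle are in `S`,
then the original triangle is in `S`. -/
def SaturatedBase (S : Set (Triangle C)) : Prop :=
  ∀ T ∈ (distinguishedTriangles : Set (Triangle C)),
    ∀ (M G E : C) (α : M ⟶ G) (δ : M ⟶ E) (f' : T.obj₁ ⟶ G) (g' : G ⟶ E)
      (h' : E ⟶ T.obj₁⟦(1 : ℤ)⟧) (β : G ⟶ T.obj₂) (ε : E ⟶ T.obj₃)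
      (γ : T.obj₂ ⟶ M⟦(1 : ℤ)⟧) (ζ : T.obj₃ ⟶ M⟦(1 : ℤ)⟧),
      Triangle.mk α β γ ∈ (distinguishedTriangles : Set (Triangle C)) →
      Triangle.mk f' g' h' ∈ S → Triangle.mk δ ε ζ ∈ S →
      α ≫ g' = δ → f' ≫ β = T.mor₁ → g' ≫ ε = β ≫ T.mor₂ → h' = ε ≫ T.mor₃ →
      T.mor₂ ≫ ζ = γ → T ∈ S

/-- Saturation of a class of triangles with respect to cobase change: in a cobase change
diagram, if the second vertical triangle and the third horizontal triangle are in `S`,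
then the original triangle is in `S`. -/
def SaturatedCobase (S : Set (Triangle C)) : Prop :=
  ∀ T ∈ (distinguishedTriangles : Set (Triangle C)),
    ∀ (N D F : C) (ζ : N ⟶ T.obj₁) (δ : N ⟶ T.obj₂) (α : T.obj₁ ⟶ D) (β : T.obj₂ ⟶ F)
      (f' : D ⟶ F) (g' : F ⟶ T.obj₃) (h' : T.obj₃ ⟶ D⟦(1 : ℤ)⟧)
      (η : D ⟶ N⟦(1 : ℤ)⟧) (υ : F ⟶ N⟦(1 : ℤ)⟧),
      Triangle.mk ζ α η ∈ (distinguishedTriangles : Set (Triangle C)) →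
      Triangle.mk δ β υ ∈ S → Triangle.mk f' g' h' ∈ S →
      ζ ≫ T.mor₁ = δ → T.mor₁ ≫ β = α ≫ f' → T.mor₂ = β ≫ g' →
      T.mor₃ ≫ (shiftFunctor C (1 : ℤ)).map α = h' → f' ≫ υ = η → T ∈ S

/-- A proper class of triangles in the sense of Beligiannis. -/
structure IsProperClass (S : Set (Triangle C)) : Prop where
  subset_dist : S ⊆ (distinguishedTriangles : Set (Triangle C))
  split_mem : ∀ T : Triangle C, T ∈ (distinguishedTriangles : Set (Triangle C)) →
    IsSplitTriangle T → T ∈ S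
  iso_closed : ∀ T₁ T₂ : Triangle C, Nonempty (T₁ ≅ T₂) → T₁ ∈ S → T₂ ∈ S
  sum_closed : ∀ T₁ ∈ S, ∀ T₂ ∈ S, ∀ T ∈ (distinguishedTriangles : Set (Triangle C)),
    Nonempty (T.obj₁ ≅ T₁.obj₁ ⊞ T₂.obj₁) →
    (∀ e₁ : T.obj₁ ≅ T₁.obj₁ ⊞ T₂.obj₁, ∀ e₂ : T.obj₂ ≅ T₁.obj₂ ⊞ T₂.obj₂,
      ∀ e₃ : T.obj₃ ≅ T₁.obj₃ ⊞ T₂.obj₃,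
      T.mor₁ = e₁.hom ≫ biprod.map T₁.mor₁ T₂.mor₁ ≫ e₂.inv →
      T.mor₂ = e₂.hom ≫ biprod.map T₁.mor₂ T₂.mor₂ ≫ e₃.inv →
      T.mor₃ = e₃.hom ≫ biprod.desc
        (T₁.mor₃ ≫ (shiftFunctor C (1 : ℤ)).map (biprod.inl ≫ e₁.inv))
        (T₂.mor₃ ≫ (shiftFunctor C (1 : ℤ)).map (biprod.inr ≫ e₁.inv)) → T ∈ S)
  susp_closed : ∀ T ∈ S, ∀ i : ℤ, (Triangle.shiftFunctor C i).obj T ∈ S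
  saturated : SaturatedBase S
  base_change : ∀ T ∈ S, ∀ {E : C} (ε : E ⟶ T.obj₃),
    ∃ (G : C) (f' : T.obj₁ ⟶ G) (g' : G ⟶ E) (h' : E ⟶ T.obj₁⟦(1 : ℤ)⟧) (β : G ⟶ T.obj₂),
      Triangle.mk f' g' h' ∈ S ∧ f' ≫ β = T.mor₁ ∧ g' ≫ ε = β ≫ T.mor₂ ∧ h' = ε ≫ T.mor₃
  cobase_change : ∀ T ∈ S, ∀ {D : C} (α : T.obj₁ ⟶ D),
    ∃ (F : C) (f' : D ⟶ F) (g' : F ⟶ T.obj₃) (h' : T.obj₃ ⟶ D⟦(1 : ℤ)⟧) (β : T.obj₂ ⟶ F),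
      Triangle.mk f' g' h' ∈ S ∧ T.mor₁ ≫ β = α ≫ f' ∧ T.mor₂ = β ≫ g' ∧
      T.mor₃ ≫ (shiftFunctor C (1 : ℤ)).map α = h'

/-- `P` is a `ξ`-projective object. -/
def XiProjective (S : Set (Triangle C)) (P : C) : Prop :=
  ∀ T ∈ S, CoExact T P

/-- `𝒞` has enough `ξ`-projectives. -/
def HasEnoughXiProjectives (S : Set (Triangle C)) : Prop :=
  ∀ A : C, ∃ (K P : C) (f : K ⟶ P) (g : P ⟶ A) (h : A ⟶ K⟦(1 : ℤ)⟧),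
    XiProjective S P ∧ Triangle.mk f g h ∈ S

/-- The objects admitting a complete resolution by triangles in `S` with middle terms in
`X` which are `Hom(-, Y)`-exact; `GClass S X X` is the Gorenstein category `𝒢(X)` and
`GClass S (XiProjective S) (XiProjective S)` is the class of `ξ`-Gorenstein projectives. -/
def GClass (S : Set (Triangle C)) (X Y : C → Prop) (A : C) : Prop :=
  ∃ (K P : ℤ → C) (f : ∀ n : ℤ, K (n + 1) ⟶ P n) (g : ∀ n : ℤ, P n ⟶ K n)
    (h : ∀ n : ℤ, K n ⟶ (K (n + 1))⟦(1 : ℤ)⟧),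
    K 0 = A ∧ ∀ n : ℤ, X (P n) ∧ Triangle.mk (f n) (g n) (h n) ∈ S ∧
      ∀ Q : C, Y Q → ContraExact (Triangle.mk (f n) (g n) (h n)) Q

/-- `ξ`-Gorenstein projective objects. -/
def GProjective (S : Set (Triangle C)) (A : C) : Prop :=
  GClass S (XiProjective S) (XiProjective S) A

/-- A `ξ`-exact resolution `⋯ → X₁ → X₀ → A → 0` with terms satisfying `X`, which is
`Hom(-, Q)`-exact for every `Q` satisfying `Y`. -/
def HasResolution (S : Set (Triangle C)) (X Y : C → Prop) (A : C) : Prop :=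
  ∃ (K G : ℕ → C) (f : ∀ n : ℕ, K (n + 1) ⟶ G n) (g : ∀ n : ℕ, G n ⟶ K n)
    (h : ∀ n : ℕ, K n ⟶ (K (n + 1))⟦(1 : ℤ)⟧),
    K 0 = A ∧ ∀ n : ℕ, X (G n) ∧ Triangle.mk (f n) (g n) (h n) ∈ S ∧
      ∀ Q : C, Y Q → ContraExact (Triangle.mk (f n) (g n) (h n)) Q

/-- A `ξ`-exact coresolution `0 → A → X⁰ → X¹ → ⋯` with terms satisfying `X`, which is
`Hom(-, Q)`-exact for every `Q` satisfying `Y`. -/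
def HasCoresolution (S : Set (Triangle C)) (X Y : C → Prop) (A : C) : Prop :=
  ∃ (K G : ℕ → C) (f : ∀ n : ℕ, K n ⟶ G n) (g : ∀ n : ℕ, G n ⟶ K (n + 1))
    (h : ∀ n : ℕ, K (n + 1) ⟶ (K n)⟦(1 : ℤ)⟧),
    K 0 = A ∧ ∀ n : ℕ, X (G n) ∧ Triangle.mk (f n) (g n) (h n) ∈ S ∧
      ∀ Q : C, Y Q → ContraExact (Triangle.mk (f n) (g n) (h n)) Q

/-- A finite `ξ`-exact sequence `0 → Gₙ → ⋯ → G₀ → A → 0` where the `j`-th term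
satisfies the predicate `X j`. -/
def FiniteRes (S : Set (Triangle C)) (n : ℕ) (X : ℕ → C → Prop) (A : C) : Prop :=
  ∃ (K G : ℕ → C) (f : ∀ j : ℕ, K (j + 1) ⟶ G j) (g : ∀ j : ℕ, G j ⟶ K j)
    (h : ∀ j : ℕ, K j ⟶ (K (j + 1))⟦(1 : ℤ)⟧),
    K 0 = A ∧ IsZero (K (n + 1)) ∧
    ∀ j ≤ n, X j (G j) ∧ Triangle.mk (f j) (g j) (h j) ∈ S

/-- `ξ`-Gorenstein projective dimension of `A` is at most `n`. -/
def GpdLE (S : Set (Triangle C)) (A : C) (n : ℕ) : Prop :=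
  FiniteRes S n (fun _ => GProjective S) A

section Triangulation

variable {X Y Z W : C} {f : X ⟶ Y} {g : Y ⟶ Z} {h : Z ⟶ X⟦(1 : ℤ)⟧}

lemma comp_eq_zero_of_lift (hT : Triangle.mk f g h ∈ distTriang C) (q : W ⟶ Y) :
    (q ≫ g) ≫ h = 0 := by
  have hgh : g ≫ h = 0 := comp_distTriang_mor_zero₂₃ _ hT
  rw [Category.assoc, hgh, comp_zero]

lemma exists_lift₁ (hT : Triangle.mk f g h ∈ distTriang C) (q : W ⟶ X⟦(1 : ℤ)⟧)
    (hq : q ≫ f⟦(1 : ℤ)⟧' = 0) : ∃ p : W ⟶ Z, q = p ≫ h :=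
  Triangle.coyoneda_exact₁ _ hT q hq

lemma exists_lift₂ (hT : Triangle.mk f g h ∈ distTriang C) (q : W ⟶ Y) (hq : q ≫ g = 0) :
    ∃ p : W ⟶ X, q = p ≫ f :=
  Triangle.coyoneda_exact₂ _ hT q hq

lemma exists_lift₃ (hT : Triangle.mk f g h ∈ distTriang C) (q : W ⟶ Z) (hq : q ≫ h = 0) :
    ∃ p : W ⟶ Y, q = p ≫ g :=
  Triangle.coyoneda_exact₃ _ hT q hq

lemma exists_desc₁ (hT : Triangle.mk f g h ∈ distTriang C) (q : X⟦(1 : ℤ)⟧ ⟶ W)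
    (hq : h ≫ q = 0) : ∃ p : Y⟦(1 : ℤ)⟧ ⟶ W, q = f⟦(1 : ℤ)⟧' ≫ p := by
  obtain ⟨p, hp⟩ : ∃ p : Y⟦(1 : ℤ)⟧ ⟶ W, q = (-f⟦(1 : ℤ)⟧') ≫ p :=
    Triangle.yoneda_exact₃ _ (rot_of_distTriang _ hT) q hq
  exact ⟨-p, by rw [hp, Preadditive.neg_comp, Preadditive.comp_neg]⟩

lemma exists_desc₂ (hT : Triangle.mk f g h ∈ distTriang C) (q : Y ⟶ W) (hq : f ≫ q = 0) :
    ∃ p : Z ⟶ W, q = g ≫ p :=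
  Triangle.yoneda_exact₂ _ hT q hq

lemma exists_desc₃ (hT : Triangle.mk f g h ∈ distTriang C) (q : Z ⟶ W) (hq : g ≫ q = 0) :
    ∃ p : X⟦(1 : ℤ)⟧ ⟶ W, q = h ≫ p :=
  Triangle.yoneda_exact₃ _ hT q hq

/-- A distinguished triangle whose connecting morphism vanishes is split. -/
lemma isSplitTriangle_of_mor₃_eq_zero {T : Triangle C} (hT : T ∈ distTriang C)
    (h0 : T.mor₃ = 0) : IsSplitTriangle T := by
  obtain ⟨e, he₁, he₂⟩ := exists_iso_binaryBiproduct_of_distTriang T hT h0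
  exact ⟨Triangle.isoMk _ _ (Iso.refl T.obj₁) e (Iso.refl T.obj₃)
    (he₁.trans (Category.id_comp _).symm) ((Category.comp_id _).trans he₂)
    (by rw [h0, zero_comp]; exact comp_zero.symm)⟩

/-- In a split triangle the two outer terms can be exchanged. -/
lemma exists_distTriang_swap (hT : Triangle.mk f g (0 : Z ⟶ X⟦(1 : ℤ)⟧) ∈ distTriang C) :
    ∃ (i : Z ⟶ Y) (p : Y ⟶ X), Triangle.mk i p (0 : X ⟶ Z⟦(1 : ℤ)⟧) ∈ distTriang C := by
  obtain ⟨e, -, -⟩ := exists_iso_binaryBiproduct_of_distTriang _ hT rfl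
  let e' : Y ≅ Z ⊞ X := e ≪≫ biprod.braiding X Z
  refine ⟨biprod.inl ≫ e'.inv, e'.hom ≫ biprod.snd,
    isomorphic_distinguished _ (binaryBiproductTriangle_distinguished Z X) _
      (Triangle.isoMk _ _ (Iso.refl Z) e' (Iso.refl X) ?_ ?_ ?_)⟩
  · have he : (biprod.inl ≫ e'.inv) ≫ e'.hom = 𝟙 Z ≫ biprod.inl := by simp
    exact he
  · exact Category.comp_id _
  · exact zero_comp.trans comp_zero.symm

end Triangulation

section ProperClass

set_option linter.unusedSectionVars false

variable {S : Set (Triangle C)}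

lemma XiProjective.shift (hS : IsProperClass S) {Q : C} (hQ : XiProjective S Q) :
    XiProjective S (Q⟦(1 : ℤ)⟧) := by
  intro T hT
  obtain ⟨inj, -, surj⟩ := hQ _ (hS.susp_closed T hT (-1))
  let adj : shiftFunctor C (1 : ℤ) ⊣ shiftFunctor C (-1 : ℤ) := (shiftEquiv C (1 : ℤ)).toAdjunction
  refine ⟨fun φ φ' hφ => (adj.homEquiv _ _).injective (inj ?_),
    fun φ hφ => Triangle.coyoneda_exact₂ T (hS.subset_dist hT) φ hφ, fun φ => ?_⟩
  · have h : adj.homEquiv Q T.obj₁ φ ≫ T.mor₁⟦(-1 : ℤ)⟧' =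
        adj.homEquiv Q T.obj₁ φ' ≫ T.mor₁⟦(-1 : ℤ)⟧' :=
      (adj.homEquiv_naturality_right φ T.mor₁).symm.trans
        ((congrArg (adj.homEquiv _ _) hφ).trans (adj.homEquiv_naturality_right φ' T.mor₁))
    change adj.homEquiv Q T.obj₁ φ ≫ (Int.negOnePow (-1) • T.mor₁⟦(-1 : ℤ)⟧') =
      adj.homEquiv Q T.obj₁ φ' ≫ (Int.negOnePow (-1) • T.mor₁⟦(-1 : ℤ)⟧')
    rw [Linear.comp_units_smul, Linear.comp_units_smul, h]
  · obtain ⟨ψ, hψ⟩ : ∃ ψ : Q ⟶ T.obj₂⟦(-1 : ℤ)⟧,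
        ψ ≫ (Int.negOnePow (-1) • T.mor₂⟦(-1 : ℤ)⟧') = adj.homEquiv Q T.obj₃ φ :=
      surj (adj.homEquiv _ _ φ)
    refine ⟨(adj.homEquiv Q T.obj₂).symm (Int.negOnePow (-1) • ψ),
      (adj.homEquiv _ _).injective ?_⟩
    refine (adj.homEquiv_naturality_right _ T.mor₂).trans ?_
    rw [Equiv.apply_symm_apply, ← hψ]
    exact (Linear.units_smul_comp ..).trans (Linear.comp_units_smul ..).symm

variable (S) in
/-- A morphism is phantom if it is annihilated by composition with morphisms from and to
`ξ`-projective objects. -/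
def Phantom {X Y : C} (h : X ⟶ Y) : Prop :=
  ∀ Q : C, XiProjective S Q → (∀ q : Q ⟶ X, q ≫ h = 0) ∧ ∀ r : Y ⟶ Q, h ≫ r = 0

lemma Phantom.zero {X Y : C} : Phantom S (0 : X ⟶ Y) :=
  fun _ _ => ⟨fun _ => comp_zero, fun _ => zero_comp⟩

lemma Phantom.precomp {X Y Z : C} {h : Y ⟶ Z} (hh : Phantom S h) (u : X ⟶ Y) :
    Phantom S (u ≫ h) := fun Q hQ =>
  ⟨fun q => by rw [← Category.assoc]; exact (hh Q hQ).1 _,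
    fun r => by rw [Category.assoc, (hh Q hQ).2, comp_zero]⟩

lemma Phantom.comp {X Y Z : C} {h : X ⟶ Y} (hh : Phantom S h) (u : Y ⟶ Z) :
    Phantom S (h ≫ u) := fun Q hQ =>
  ⟨fun q => by rw [← Category.assoc, (hh Q hQ).1, zero_comp],
    fun r => by rw [Category.assoc]; exact (hh Q hQ).2 _⟩

lemma mem_of_forall_comp_eq_zero [IsTriangulated C] (hS : IsProperClass S)
    (hE : HasEnoughXiProjectives S) {T : Triangle C} (hT : T ∈ distTriang C)
    (hT' : ∀ Q : C, XiProjective S Q → ∀ q : Q ⟶ T.obj₃, q ≫ T.mor₃ = 0) : T ∈ S := by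
  obtain ⟨M, P, k, ε, ζ, hP, hM⟩ := hE T.obj₃
  obtain ⟨G, f', g', hG⟩ := distinguished_cocone_triangle₂ (ε ≫ T.mor₃)
  have hT₁ : Triangle.mk T.mor₂ T.mor₃ (-T.mor₁⟦(1 : ℤ)⟧') ∈ distTriang C :=
    rot_of_distTriang _ hT
  have hG₁ : Triangle.mk g' (ε ≫ T.mor₃) (-f'⟦(1 : ℤ)⟧') ∈ distTriang C :=
    rot_of_distTriang _ hG
  have o := Triangulated.someOctahedron' rfl (hS.subset_dist hM) hT₁ hG₁
  refine hS.saturated T hT M G P o.m₁ k f' g' (ε ≫ T.mor₃) o.m₃ ε (T.mor₂ ≫ ζ) ζ o.mem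
    (hS.split_mem _ hG (isSplitTriangle_of_mor₃_eq_zero hG (hT' P hP ε))) hM o.comm₁ ?_
    o.comm₄.symm rfl rfl
  apply (shiftFunctor C (1 : ℤ)).map_injective
  have := o.comm₃
  rw [Preadditive.neg_comp, neg_inj] at this
  rw [Functor.map_comp, this]

/-- The triangles in `ξ` which are `Hom(-, 𝒫(ξ))`-exact are the distinguished triangles with
phantom connecting morphism. -/
lemma mem_and_contraExact_iff [IsTriangulated C] (hS : IsProperClass S)
    (hE : HasEnoughXiProjectives S) (T : Triangle C) :
    (T ∈ S ∧ ∀ Q : C, XiProjective S Q → ContraExact T Q) ↔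
      T ∈ distTriang C ∧ Phantom S T.mor₃ := by
  constructor
  · rintro ⟨hT, hC⟩
    refine ⟨hS.subset_dist hT, fun Q hQ => ⟨fun q => ?_, fun r => (hC Q hQ).1 ?_⟩⟩
    · obtain ⟨q', rfl⟩ := (hQ T hT).2.2 q
      exact comp_eq_zero_of_lift (hS.subset_dist hT) q'
    · have := comp_distTriang_mor_zero₂₃ _ (hS.subset_dist hT)
      dsimp
      rw [reassoc_of% this, zero_comp, comp_zero]
  · rintro ⟨hT, hP⟩
    refine ⟨mem_of_forall_comp_eq_zero hS hE hT fun Q hQ => (hP Q hQ).1,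
      fun Q hQ => ⟨fun φ φ' hφ => ?_, fun φ hφ => T.yoneda_exact₂ hT φ hφ, fun φ => ?_⟩⟩
    · dsimp at hφ
      obtain ⟨r, hr⟩ := T.yoneda_exact₃ hT (φ - φ')
        (by rw [Preadditive.comp_sub, hφ, sub_self])
      rw [(hP Q hQ).2 r] at hr
      exact sub_eq_zero.1 hr
    · obtain ⟨ψ, hψ⟩ := exists_desc₁ hT (φ⟦(1 : ℤ)⟧') ((hP _ (hQ.shift hS)).2 _)
      obtain ⟨ψ, rfl⟩ := (shiftFunctor C (1 : ℤ)).map_surjective ψ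
      exact ⟨ψ, (shiftFunctor C (1 : ℤ)).map_injective
        (((shiftFunctor C (1 : ℤ)).map_comp _ _).trans hψ.symm)⟩

variable (S) in
/-- `X` and `Z` are the outer terms, and `Y` the middle term, of a distinguished triangle with
phantom connecting morphism. -/
def IsConflation (X Y Z : C) : Prop :=
  ∃ (f : X ⟶ Y) (g : Y ⟶ Z) (h : Z ⟶ X⟦(1 : ℤ)⟧),
    Triangle.mk f g h ∈ distTriang C ∧ Phantom S h

namespace IsConflation

variable {A B D E F : C}

lemma swap_of_projective_right (hF : XiProjective S F) (h : IsConflation S A B F) :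
    IsConflation S F B A := by
  obtain ⟨f, g, h, hT, hp⟩ := h
  obtain rfl : h = 0 := by simpa using (hp F hF).1 (𝟙 F)
  obtain ⟨i, p, hT'⟩ := exists_distTriang_swap hT
  exact ⟨i, p, 0, hT', Phantom.zero⟩

lemma swap_of_projective_left (hS : IsProperClass S) (hA : XiProjective S A)
    (h : IsConflation S A B F) : IsConflation S F B A := by
  obtain ⟨f, g, h, hT, hp⟩ := h
  obtain rfl : h = 0 := by simpa using (hp _ (hA.shift hS)).2 (𝟙 _)
  obtain ⟨i, p, hT'⟩ := exists_distTriang_swap hT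
  exact ⟨i, p, 0, hT', Phantom.zero⟩

variable (S A) in
lemma biprod_self : IsConflation S A (A ⊞ A) A :=
  ⟨_, _, _, binaryBiproductTriangle_distinguished A A, Phantom.zero⟩

/-- An extension of `ξ`-projective objects is `ξ`-projective. -/
lemma projective (hS : IsProperClass S) (h : IsConflation S A B F) (hA : XiProjective S A)
    (hF : XiProjective S F) : XiProjective S B := by
  obtain ⟨f, g, h, hT, hp⟩ := h
  obtain rfl : h = 0 := by simpa using (hp F hF).1 (𝟙 F)
  obtain ⟨s, hs⟩ := exists_lift₃ hT (𝟙 F) comp_zero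
  obtain ⟨r, hr⟩ := exists_lift₂ hT (𝟙 B - g ≫ s)
    (by rw [Preadditive.sub_comp, Category.assoc, ← hs]; simp)
  have hid : 𝟙 B = r ≫ f + g ≫ s := by rw [← hr]; abel
  have ext {Z : C} {φ φ' : B ⟶ Z} (h₁ : f ≫ φ = f ≫ φ') (h₂ : s ≫ φ = s ≫ φ') : φ = φ' := by
    rw [← Category.id_comp φ, ← Category.id_comp φ', hid]
    simp only [Preadditive.add_comp, Category.assoc, h₁, h₂]
  intro T hT'
  refine ⟨fun φ φ' hφ => ext ((hA T hT').1 ?_) ((hF T hT').1 ?_),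
    fun φ hφ => T.coyoneda_exact₂ (hS.subset_dist hT') φ hφ, fun φ => ?_⟩
  · simpa using congrArg (f ≫ ·) hφ
  · simpa using congrArg (s ≫ ·) hφ
  · obtain ⟨a, ha⟩ := (hA T hT').2.2 (f ≫ φ)
    obtain ⟨b, hb⟩ := (hF T hT').2.2 (s ≫ φ)
    refine ⟨r ≫ a + g ≫ b, ?_⟩
    dsimp at ha hb ⊢
    rw [Preadditive.add_comp, Category.assoc, Category.assoc, ha, hb, ← Category.assoc,
      ← Category.assoc, ← Preadditive.add_comp, ← hid, Category.id_comp]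

variable [IsTriangulated C]

/-- Composition of inflations. -/
lemma comp_inflation (h₁ : IsConflation S A B F) (h₂ : IsConflation S B D E) :
    ∃ G, IsConflation S A D G ∧ IsConflation S F G E := by
  obtain ⟨f₁, g₁, h₁, T₁, p₁⟩ := h₁
  obtain ⟨f₂, g₂, h₂, T₂, p₂⟩ := h₂
  obtain ⟨G, v, w, T₃⟩ := distinguished_cocone_triangle (f₁ ≫ f₂)
  have o := Triangulated.someOctahedron rfl T₁ T₂ T₃
  refine ⟨G, ⟨_, _, _, T₃, fun Q hQ => ⟨fun q => ?_, fun r => ?_⟩⟩,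
    ⟨_, _, _, o.mem, p₂.comp _⟩⟩
  · obtain ⟨s, hs⟩ := exists_lift₁ T₁ (q ≫ w)
      (by rw [Category.assoc, o.comm₄, ← Category.assoc, (p₂ Q hQ).1])
    rw [hs]
    exact (p₁ Q hQ).1 s
  · obtain ⟨r', rfl⟩ := exists_desc₁ T₁ r ((p₁ Q hQ).2 r)
    rw [← Category.assoc, o.comm₄, Category.assoc, (p₂ Q hQ).2, comp_zero]

/-- Composition of deflations. -/
lemma comp_deflation (h₁ : IsConflation S A B F) (h₂ : IsConflation S D F E) :
    ∃ G, IsConflation S G B E ∧ IsConflation S A G D := by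
  obtain ⟨f₁, g₁, h₁, T₁, p₁⟩ := h₁
  obtain ⟨f₂, g₂, h₂, T₂, p₂⟩ := h₂
  obtain ⟨G, v, w, T₃⟩ := distinguished_cocone_triangle₁ (g₁ ≫ g₂)
  have o := Triangulated.someOctahedron' rfl T₁ T₂ T₃
  refine ⟨G, ⟨_, _, _, T₃, fun Q hQ => ⟨fun q => ?_, fun r => ?_⟩⟩,
    ⟨_, _, _, o.mem, p₁.precomp _⟩⟩
  · obtain ⟨q, rfl⟩ := exists_lift₃ T₂ q ((p₂ Q hQ).1 q)
    obtain ⟨q, rfl⟩ := exists_lift₃ T₁ q ((p₁ Q hQ).1 q)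
    rw [Category.assoc q]
    exact comp_eq_zero_of_lift T₃ q
  · obtain ⟨s, hs⟩ := exists_desc₃ T₂ (w ≫ r)
      (by rw [← Category.assoc, ← o.comm₂, Category.assoc, (p₁ Q hQ).2])
    rw [hs]
    exact (p₂ Q hQ).2 s

/-- Pullback of a deflation along a deflation. -/
lemma pullback (h₁ : IsConflation S A B F) (h₂ : IsConflation S D E F) :
    ∃ G, IsConflation S A G E ∧ IsConflation S D G B := by
  obtain ⟨f₁, g₁, h₁, T₁, p₁⟩ := h₁
  obtain ⟨f₂, g₂, h₂, T₂, p₂⟩ := h₂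
  obtain ⟨G, v, w, T₃⟩ := distinguished_cocone_triangle₂ (g₂ ≫ h₁)
  have o := Triangulated.someOctahedron' rfl T₂ (rot_of_distTriang _ T₁) (rot_of_distTriang _ T₃)
  exact ⟨G, ⟨_, _, _, T₃, p₁.precomp _⟩, ⟨_, _, _, o.mem, p₂.precomp _⟩⟩

/-- Pushout of an inflation along an inflation. -/
lemma pushout (h₁ : IsConflation S A B F) (h₂ : IsConflation S A D E) :
    ∃ G, IsConflation S B G E ∧ IsConflation S D G F := by
  obtain ⟨f₁, g₁, h₁, T₁, p₁⟩ := h₁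
  obtain ⟨f₂, g₂, h₂, T₂, p₂⟩ := h₂
  obtain ⟨G, v, w, T₃⟩ := distinguished_cocone_triangle₂ (h₂ ≫ (-f₁⟦(1 : ℤ)⟧'))
  have o := Triangulated.someOctahedron' rfl (rot_of_distTriang _ T₂)
    (rot_of_distTriang _ (rot_of_distTriang _ T₁)) (rot_of_distTriang _ T₃)
  exact ⟨G, ⟨_, _, _, T₃, p₂.comp _⟩, ⟨_, _, _, o.mem, p₁.comp _⟩⟩

end IsConflation

variable [IsTriangulated C]

lemma gProjective_iff (hS : IsProperClass S) (hE : HasEnoughXiProjectives S) (A : C) :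
    GProjective S A ↔ ∃ K : ℤ → C, K 0 = A ∧
      ∀ n, ∃ P, XiProjective S P ∧ IsConflation S (K (n + 1)) P (K n) := by
  constructor
  · rintro ⟨K, P, f, g, h, h0, hn⟩
    exact ⟨K, h0, fun n => ⟨P n, (hn n).1, f n, g n, h n,
      (mem_and_contraExact_iff hS hE _).1 (hn n).2⟩⟩
  · rintro ⟨K, h0, hn⟩
    choose P hP f g h hT using hn
    exact ⟨K, P, f, g, h, h0, fun n => ⟨hP n, (mem_and_contraExact_iff hS hE _).2 (hT n)⟩⟩

lemma GProjective.exists_syzygy (hS : IsProperClass S) (hE : HasEnoughXiProjectives S) {A : C}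
    (hA : GProjective S A) :
    ∃ A' P, XiProjective S P ∧ IsConflation S A' P A ∧ GProjective S A' := by
  obtain ⟨K, rfl, hK⟩ := (gProjective_iff hS hE _).1 hA
  obtain ⟨P, hP, hT⟩ := hK 0
  exact ⟨_, P, hP, hT, (gProjective_iff hS hE _).2 ⟨fun n => K (n + 1), rfl, fun n => hK (n + 1)⟩⟩

lemma GProjective.exists_cosyzygy (hS : IsProperClass S) (hE : HasEnoughXiProjectives S) {A : C}
    (hA : GProjective S A) :
    ∃ A' P, XiProjective S P ∧ IsConflation S A P A' ∧ GProjective S A' := by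
  obtain ⟨K, rfl, hK⟩ := (gProjective_iff hS hE _).1 hA
  obtain ⟨P, hP, hT⟩ := hK (-1)
  refine ⟨_, P, hP, hT, (gProjective_iff hS hE _).2 ⟨fun n => K (n - 1), rfl, fun n => ?_⟩⟩
  obtain ⟨P, hP, hT⟩ := hK (n - 1)
  exact ⟨P, hP, by convert hT using 2; ring⟩

/-- Two predicates closed under the two directions of a relation produce a bi-infinite chain. -/
lemma exists_int_chain {α : Type*} {R : α → α → Prop} {X Y : α → Prop}
    (hX : ∀ a, X a → ∃ b, R b a ∧ X b) (hY : ∀ a, Y a → ∃ b, R a b ∧ Y b)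
    {a : α} (ha : X a) (ha' : Y a) :
    ∃ K : ℤ → α, K 0 = a ∧ ∀ n, R (K (n + 1)) (K n) := by
  choose l hl using fun x : {x // X x} => hX x.1 x.2
  choose r hr using fun y : {y // Y y} => hY y.1 y.2
  let u : ℕ → {x // X x} := fun n => n.rec ⟨a, ha⟩ fun _ x => ⟨l x, (hl x).2⟩
  let v : ℕ → {y // Y y} := fun n => n.rec ⟨a, ha'⟩ fun _ y => ⟨r y, (hr y).2⟩
  refine ⟨fun n => match n with
    | .ofNat n => (u n).1
    | .negSucc n => (v (n + 1)).1, rfl, fun n => ?_⟩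
  match n with
  | .ofNat n => exact (hl (u n)).1
  | .negSucc 0 => exact (hr (v 0)).1
  | .negSucc (n + 1) => exact (hr (v (n + 1))).1

/-- Coinduction principle for `ξ`-Gorenstein projective objects. -/
lemma GProjective.of_closed (hS : IsProperClass S) (hE : HasEnoughXiProjectives S)
    {X Y : C → Prop}
    (hX : ∀ A, X A → ∃ A' P, XiProjective S P ∧ IsConflation S A' P A ∧ X A')
    (hY : ∀ A, Y A → ∃ A' P, XiProjective S P ∧ IsConflation S A P A' ∧ Y A')
    {A : C} (hA : X A) (hA' : Y A) : GProjective S A := by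
  rw [gProjective_iff hS hE]
  refine exists_int_chain (R := fun B A => ∃ P, XiProjective S P ∧ IsConflation S B P A)
    (X := X) (Y := Y) (fun a ha => ?_) (fun a ha => ?_) hA hA'
  · obtain ⟨A', P, hP, hT, h⟩ := hX a ha
    exact ⟨A', ⟨P, hP, hT⟩, h⟩
  · obtain ⟨A', P, hP, hT, h⟩ := hY a ha
    exact ⟨A', ⟨P, hP, hT⟩, h⟩

/-- The class of `ξ`-Gorenstein projective objects is closed under extensions. -/
lemma GProjective.of_isConflation (hS : IsProperClass S) (hE : HasEnoughXiProjectives S)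
    {G₁ D G₂ : C} (h₁ : GProjective S G₁) (h₂ : GProjective S G₂)
    (hD : IsConflation S G₁ D G₂) : GProjective S D := by
  let X : C → Prop := fun D =>
    ∃ G₁ G₂, GProjective S G₁ ∧ GProjective S G₂ ∧ IsConflation S G₁ D G₂
  refine GProjective.of_closed hS hE (X := X) (Y := X) ?_ ?_
    ⟨G₁, G₂, h₁, h₂, hD⟩ ⟨G₁, G₂, h₁, h₂, hD⟩
  · rintro D ⟨G₁, G₂, h₁, h₂, hD⟩
    obtain ⟨G₁', P₁, hP₁, c₁, h₁'⟩ := h₁.exists_syzygy hS hE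
    obtain ⟨G₂', P₂, hP₂, c₂, h₂'⟩ := h₂.exists_syzygy hS hE
    obtain ⟨W, w₁, w₂⟩ := hD.pullback c₂
    obtain ⟨P, p₁, p₂⟩ := (w₁.swap_of_projective_right hP₂).pullback c₁
    obtain ⟨D', d₁, d₂⟩ := p₂.comp_deflation w₂
    exact ⟨D', P, p₁.projective hS hP₂ hP₁, d₁, G₁', G₂', h₁', h₂', d₂⟩
  · rintro D ⟨G₁, G₂, h₁, h₂, hD⟩
    obtain ⟨G₁', P₁, hP₁, c₁, h₁'⟩ := h₁.exists_cosyzygy hS hE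
    obtain ⟨G₂', P₂, hP₂, c₂, h₂'⟩ := h₂.exists_cosyzygy hS hE
    obtain ⟨W, w₁, w₂⟩ := hD.pushout c₁
    obtain ⟨P, p₁, p₂⟩ := (w₂.swap_of_projective_left hS hP₁).pushout c₂
    obtain ⟨D', d₁, d₂⟩ := w₁.comp_inflation p₁
    exact ⟨D', P, p₂.projective hS hP₂ hP₁, d₁, G₁', G₂', h₁', h₂', d₂⟩

/-- An object which is an extension of itself by itself inside a `ξ`-Gorenstein projective
object is `ξ`-Gorenstein projective. -/
lemma GProjective.of_self_conflation (hS : IsProperClass S) (hE : HasEnoughXiProjectives S)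
    {A G : C} (hG : GProjective S G) (hA : IsConflation S A G A) : GProjective S A := by
  refine GProjective.of_closed hS hE (X := fun Y => ∃ G, GProjective S G ∧ IsConflation S A G Y)
    (Y := fun Y => ∃ G, GProjective S G ∧ IsConflation S Y G A) ?_ ?_ ⟨G, hG, hA⟩ ⟨G, hG, hA⟩
  · rintro Y ⟨G₀, h₀, c⟩
    obtain ⟨G', P, hP, cP, h'⟩ := h₀.exists_syzygy hS hE
    obtain ⟨K, k₁, k₂⟩ := cP.comp_deflation c
    obtain ⟨F, f₁, f₂⟩ := k₂.pullback hA
    exact ⟨K, P, hP, k₁, F, .of_isConflation hS hE h' hG f₁, f₂⟩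
  · rintro Y ⟨G₀, h₀, c⟩
    obtain ⟨G', P, hP, cP, h'⟩ := h₀.exists_cosyzygy hS hE
    obtain ⟨K, k₁, k₂⟩ := c.comp_inflation cP
    obtain ⟨F, f₁, f₂⟩ := k₂.pushout hA
    exact ⟨K, P, hP, k₁, F, .of_isConflation hS hE hG h' f₂, f₁⟩

end ProperClass

variable [IsTriangulated C]

theorem gProjective_iff_exists_triangle (S : Set (Triangle C))
    (hS : IsProperClass S) (hE : HasEnoughXiProjectives S) (A : C) :
    GProjective S A ↔
      ∃ (G : C) (f : A ⟶ G) (g : G ⟶ A) (h : A ⟶ A⟦(1 : ℤ)⟧),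
        GProjective S G ∧ Triangle.mk f g h ∈ S ∧
        ∀ Q : C, XiProjective S Q → ContraExact (Triangle.mk f g h) Q := by
  constructor
  · intro hA
    obtain ⟨f, g, h, hT⟩ := IsConflation.biprod_self S A
    exact ⟨A ⊞ A, f, g, h, .of_isConflation hS hE hA hA (.biprod_self S A),
      (mem_and_contraExact_iff hS hE _).2 hT⟩
  · rintro ⟨G, f, g, h, hG, hT⟩
    exact .of_self_conflation hS hE hG ⟨f, g, h, (mem_and_contraExact_iff hS hE _).1 hT⟩


end GorensteinTriangulated
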